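/- Lemma 2, exact version: let x : Fin K → ℕ satisfy ∑_{j=1}^K x_j = N, let H^{(k)} be the entropy of the empirical distribution obtained after assigning one additional point to cluster k, let z ∈ ℝ^d, let μ_k ∈ ℝ^d and Σ_k ∈ ℝ^{d×d} be positive definite for each k, let C > 0, and set L(k) = C · φ(z; μ_k, Σ_k). Then for every λ ∈ ℝ and all clusters k, k': log L(k) + λ·H^{(k)} > log L(k') + λ·H^{(k')} if and only if d(z, μ_k, Σ_k) + (λ/(N+1))·g(x_k) < d(z, μ_{k'}, Σ_{k'}) + (λ/(N+1))·g(x_{k'}), where g(x) = (x+1) log(x+1) − x log x with 0·log 0 = 0. -/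

import Mathlib

open Real Matrix Finset

/-- The multivariate Gaussian density
`φ(z; μ, Σ) = exp(−½ (z−μ)ᵀ Σ⁻¹ (z−μ)) / √((2π)^d · det Σ)`. -/
noncomputable def gaussDensity {d : ℕ} (z μ : Fin d → ℝ) (S : Matrix (Fin d) (Fin d) ℝ) : ℝ :=
  Real.exp (-(1 / 2) * ((z - μ) ⬝ᵥ (S⁻¹ *ᵥ (z - μ)))) / Real.sqrt ((2 * Real.pi) ^ d * S.det)

/-- The Gaussian cost
`d(z, μ, Σ) = ½ (z−μ)ᵀ Σ⁻¹ (z−μ) + ½ log(det Σ) + (d/2) log(2π)`. -/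
noncomputable def gaussCost {d : ℕ} (z μ : Fin d → ℝ) (S : Matrix (Fin d) (Fin d) ℝ) : ℝ :=
  (1 / 2) * ((z - μ) ⬝ᵥ (S⁻¹ *ᵥ (z - μ))) + (1 / 2) * Real.log S.det +
    ((d : ℝ) / 2) * Real.log (2 * Real.pi)

/-- The counts after assigning one more point to cluster `k`:
`x'ⱼ = xⱼ + 1` if `j = k` and `x'ⱼ = xⱼ` otherwise. -/
def postCounts {K : ℕ} (x : Fin K → ℕ) (k : Fin K) (j : Fin K) : ℕ :=
  if j = k then x j + 1 else x j

/-- `H^{(k)}`: the Shannon entropy of the empirical distribution `(x'ⱼ/(N+1))ⱼ` of cluster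
sizes after one more point has been assigned to cluster `k` (with the convention
`0·log 0 = 0`, which holds definitionally since `Real.log 0 = 0`). -/
noncomputable def postEnt {K : ℕ} (N : ℕ) (x : Fin K → ℕ) (k : Fin K) : ℝ :=
  -∑ j, ((postCounts x k j : ℝ) / ((N : ℝ) + 1)) *
      Real.log ((postCounts x k j : ℝ) / ((N : ℝ) + 1))

/-- `g(x) = (x+1) log(x+1) − x log x` (with the convention `0·log 0 = 0`). -/
noncomputable def gFun (x : ℝ) : ℝ :=
  (x + 1) * Real.log (x + 1) - x * Real.log x

theorem log_mul_gaussDensity {d : ℕ} (z μ : Fin d → ℝ) {S : Matrix (Fin d) (Fin d) ℝ}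
    (hS : S.PosDef) {C : ℝ} (hC : 0 < C) :
    Real.log (C * gaussDensity z μ S) = Real.log C - gaussCost z μ S := by
  have hdet := hS.det_pos
  have hpi : (0 : ℝ) < (2 * Real.pi) ^ d := by positivity
  have hsqrt : 0 < Real.sqrt ((2 * Real.pi) ^ d * S.det) := Real.sqrt_pos.2 (mul_pos hpi hdet)
  unfold gaussDensity gaussCost
  rw [Real.log_mul hC.ne' (div_pos (Real.exp_pos _) hsqrt).ne',
    Real.log_div (Real.exp_pos _).ne' hsqrt.ne', Real.log_exp,
    Real.log_sqrt (mul_pos hpi hdet).le, Real.log_mul hpi.ne' hdet.ne', Real.log_pow]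
  ring

/-- Replacing `x k` by `x k + 1` changes a sum over the clusters only in its `k`-th term. -/
theorem sum_comp_postCounts {K : ℕ} (x : Fin K → ℕ) (k : Fin K) (f : ℕ → ℝ) :
    ∑ j, f (postCounts x k j) = ∑ j, f (x j) + (f (x k + 1) - f (x k)) := by
  rw [← sub_eq_iff_eq_add', ← Finset.sum_sub_distrib,
    Finset.sum_eq_single_of_mem k (Finset.mem_univ k) fun j _ hj => by simp [postCounts, hj]]
  simp [postCounts]

theorem div_mul_log_div (m : ℝ) {n : ℝ} (hn : n ≠ 0) :
    m / n * Real.log (m / n) = (m * Real.log m - m * Real.log n) / n := by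
  rcases eq_or_ne m 0 with rfl | hm
  · simp
  · rw [Real.log_div hm hn]
    ring

theorem postEnt_eq {K N : ℕ} {x : Fin K → ℕ} (hx : ∑ j, x j = N) (k : Fin K) :
    postEnt N x k = Real.log ((N : ℝ) + 1) -
      (∑ j, (x j : ℝ) * Real.log (x j) + gFun (x k)) / ((N : ℝ) + 1) := by
  have hN : (N : ℝ) + 1 ≠ 0 := by positivity
  have hcount : ∑ j, (postCounts x k j : ℝ) = (N : ℝ) + 1 := by
    rw [sum_comp_postCounts x k fun m => (m : ℝ), ← hx]
    push_cast
    ring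
  have hlog : ∑ j, (postCounts x k j : ℝ) * Real.log (postCounts x k j) =
      ∑ j, (x j : ℝ) * Real.log (x j) + gFun (x k) := by
    rw [sum_comp_postCounts x k fun m => (m : ℝ) * Real.log m]
    simp [gFun]
  simp only [postEnt, div_mul_log_div _ hN]
  rw [← Finset.sum_div, Finset.sum_sub_distrib, ← Finset.sum_mul, hcount, hlog]
  field_simp
  ring

/-- Lemma 2, exact version: with `L(k) = C · φ(z; μₖ, Σₖ)`, for every `λ ∈ ℝ` and all
clusters `k, k'`: `log L(k) + λ·H^{(k)} > log L(k') + λ·H^{(k')}` iff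
`d(z, μₖ, Σₖ) + (λ/(N+1))·g(xₖ) < d(z, μₖ', Σₖ') + (λ/(N+1))·g(xₖ')`. -/
theorem entReg_logLik_gt_iff {K N d : ℕ} (x : Fin K → ℕ) (hx : ∑ j, x j = N)
    (z : Fin d → ℝ) (μ : Fin K → Fin d → ℝ) (S : Fin K → Matrix (Fin d) (Fin d) ℝ)
    (hS : ∀ k, (S k).PosDef) (C : ℝ) (hC : 0 < C) (lam : ℝ) (k k' : Fin K) :
    Real.log (C * gaussDensity z (μ k') (S k')) + lam * postEnt N x k' <
        Real.log (C * gaussDensity z (μ k) (S k)) + lam * postEnt N x k ↔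
      gaussCost z (μ k) (S k) + (lam / ((N : ℝ) + 1)) * gFun (x k : ℝ) <
        gaussCost z (μ k') (S k') + (lam / ((N : ℝ) + 1)) * gFun (x k' : ℝ) := by
  rw [log_mul_gaussDensity z _ (hS k) hC, log_mul_gaussDensity z _ (hS k') hC,
    postEnt_eq hx k, postEnt_eq hx k', ← sub_pos, ← sub_pos (b := _ + _ * gFun (x k))]
  apply iff_of_eq
  congr 1
  ring
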